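/- Let n ≥ 1, m ≥ 1, and let a_1, …, a_n ∈ ℂ[z] be polynomials with deg a_i ≤ m·i; let α_i be the coefficient of z^{m·i} in a_i. Assume the polynomial b^n + α_1 b^{n−1} + ⋯ + α_n ∈ ℂ[b] has n pairwise distinct roots b_1, …, b_n. Let ℂ((t)) be the field of formal Laurent series and let ã_i ∈ ℂ((t)) be obtained from a_i by substituting z = t^{−1}. Then the polynomial w^n + ã_1 w^{n−1} + ⋯ + ã_n ∈ ℂ((t))[w] splits into linear factors: there exist w_1, …, w_n ∈ ℂ((t)) with w^n + ã_1 w^{n−1} + ⋯ + ã_n = ∏_{a=1}^n (w − w_a) and t^m·w_a − b_a ∈ t·ℂ[[t]] for each a. -/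

import Mathlib

open Finset Polynomial

theorem degree_sum_C_mul_X_pow_rev_lt {R : Type*} [Semiring R] {n : ℕ} (c : Fin n → R) :
    (∑ i : Fin n, C (c i) * X ^ (n - 1 - (i : ℕ)) : R[X]).degree < n := by
  refine (degree_sum_le _ _).trans_lt ((Finset.sup_lt_iff (WithBot.bot_lt_coe n)).2 fun i _ => ?_)
  refine (degree_C_mul_X_pow_le _ _).trans_lt ?_
  have := i.isLt
  exact Nat.cast_lt.2 (by omega)

theorem X_pow_add_eq_prod_of_injective_of_eval_eq_zero {R : Type*} [CommRing R] [IsDomain R]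
    {n : ℕ} {q : R[X]} (hq : q.degree < n) {w : Fin n → R} (hw : Function.Injective w)
    (h : ∀ i, (X ^ n + q).eval (w i) = 0) : X ^ n + q = ∏ i, (X - C (w i)) := by
  have hmonic : (X ^ n + q).Monic := monic_X_pow_add hq
  have hdeg : (X ^ n + q).degree = (n : WithBot ℕ) := by
    rw [degree_add_eq_left_of_degree_lt (by simpa using hq), degree_X_pow]
  have hprod : (∏ i, (X - C (w i))).degree = (n : WithBot ℕ) := by simp [degree_prod]
  refine eq_of_degree_sub_lt_of_eval_index_eq Finset.univ hw.injOn ?_ fun i _ => ?_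
  · have := degree_sub_lt_left (hdeg.trans hprod.symm) hmonic.ne_zero
      (by rw [hmonic.leadingCoeff, (monic_prod_X_sub_C w Finset.univ).leadingCoeff])
    simpa [hdeg] using this
  · rw [h, eval_prod]
    exact (Finset.prod_eq_zero (Finset.mem_univ i) (by simp)).symm

theorem PowerSeries.exists_isRoot_of_map_constantCoeff {K : Type*} [Field K]
    {f : (PowerSeries K)[X]} (hf : f.Monic) {b : K}
    (hroot : (f.map (PowerSeries.constantCoeff (R := K))).eval b = 0)
    (hder : (f.map (PowerSeries.constantCoeff (R := K))).derivative.eval b ≠ 0) :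
    ∃ v : PowerSeries K, f.IsRoot v ∧ PowerSeries.X ∣ v - PowerSeries.C b := by
  have key (g : (PowerSeries K)[X]) : PowerSeries.constantCoeff (g.eval (PowerSeries.C b)) =
      (g.map (PowerSeries.constantCoeff (R := K))).eval b := by
    rw [← eval_map_apply, PowerSeries.constantCoeff_C]
  obtain ⟨v, hv, hvb⟩ := HenselianRing.is_henselian
    (I := Ideal.span {(PowerSeries.X : PowerSeries K)})
    f hf (PowerSeries.C b)
    (by rwa [Ideal.mem_span_singleton, PowerSeries.X_dvd_iff, key])
    (by
      refine IsUnit.map _ (PowerSeries.isUnit_iff_constantCoeff.2 ?_)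
      rw [key, ← derivative_map]
      exact hder.isUnit)
  exact ⟨v, hv, Ideal.mem_span_singleton.1 hvb⟩

theorem coe_reflect_eq_pow_mul_aeval {K : Type*} [Field K] {f : K[X]} {N : ℕ} (hf : f.natDegree ≤ N) :
    HahnSeries.ofPowerSeries ℤ K (f.reflect N : PowerSeries K) =
      (HahnSeries.single (1 : ℤ) (1 : K)) ^ N *
        aeval ((HahnSeries.single (1 : ℤ) (1 : K) : LaurentSeries K)⁻¹) f := by
  have hcoe (g : K[X]) : HahnSeries.ofPowerSeries ℤ K (g : PowerSeries K) =
      aeval (HahnSeries.single (1 : ℤ) (1 : K)) g := by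
    induction g using Polynomial.induction_on' with
    | add p q hp hq => simp [hp, hq]
    | monomial k c =>
      rw [← C_mul_X_pow_eq_monomial]
      simp [HahnSeries.ofPowerSeries_C, HahnSeries.ofPowerSeries_X, HahnSeries.algebraMap_apply']
  rw [hcoe]
  have ht : (HahnSeries.single (1 : ℤ) (1 : K) : LaurentSeries K) ≠ 0 := by simp
  let := invertibleOfNonzero (inv_ne_zero ht)
  have := eval₂_reflect_mul_pow (algebraMap K (LaurentSeries K))
    ((HahnSeries.single (1 : ℤ) (1 : K) : LaurentSeries K)⁻¹) N f hf
  rw [aeval_def, aeval_def, ← this, invOf_eq_inv, inv_inv, inv_pow, mul_comm,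
    inv_mul_cancel_right₀ (pow_ne_zero N ht)]

/-- Let `n, m ≥ 1` and `a_1, …, a_n ∈ ℂ[z]` with `deg a_i ≤ m·i`; let `α_i` be
the coefficient of `z^{m·i}` in `a_i`.  Assume `b^n + α_1 b^{n−1} + ⋯ + α_n` has `n`
pairwise distinct roots `b_1, …, b_n`.  Let `aTilde_i ∈ ℂ((t))` be `a_i` with `z = t⁻¹`
substituted.  Then `w^n + aTilde_1 w^{n−1} + ⋯ + aTilde_n` splits into linear factors over `ℂ((t))`:
there are `w_1, …, w_n ∈ ℂ((t))` with `∏ (w − w_a)` equal to it and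
`t^m·w_a − b_a ∈ t·ℂ[[t]]` for each `a`. -/
theorem stmt13 (n m : ℕ) (hn : 1 ≤ n) (hm : 1 ≤ m)
    (a : Fin n → Polynomial ℂ)
    (hdeg : ∀ i : Fin n, (a i).degree ≤ (m * ((i : ℕ) + 1) : ℕ))
    (α : Fin n → ℂ) (hα : ∀ i : Fin n, α i = (a i).coeff (m * ((i : ℕ) + 1)))
    (b : Fin n → ℂ) (hbdist : Function.Injective b)
    (hbroots : (X ^ n + ∑ i : Fin n, C (α i) * X ^ (n - 1 - (i : ℕ)) : Polynomial ℂ)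
        = ∏ i, (X - C (b i)))
    (t : LaurentSeries ℂ) (ht : t = HahnSeries.single (1 : ℤ) 1)
    (aTilde : Fin n → LaurentSeries ℂ)
    (haTilde : ∀ i, aTilde i = Polynomial.aeval t⁻¹ (a i)) :
    ∃ w : Fin n → LaurentSeries ℂ,
      ((X ^ n + ∑ i : Fin n, C (aTilde i) * X ^ (n - 1 - (i : ℕ))
          : Polynomial (LaurentSeries ℂ))
        = ∏ i, (X - C (w i))) ∧
      ∀ i : Fin n, ∃ p : PowerSeries ℂ,
        t ^ m * w i - algebraMap ℂ (LaurentSeries ℂ) (b i)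
          = t * (HahnSeries.ofPowerSeries ℤ ℂ p) := by
  have hcoeff (i : Fin n) : (HahnSeries.ofPowerSeries ℤ ℂ) ((a i).reflect (m * (i + 1)) : ℂ[X]) =
      t ^ (m * (i + 1)) * aTilde i := by
    rw [haTilde, ht]
    exact coe_reflect_eq_pow_mul_aeval (natDegree_le_of_degree_le (hdeg i))
  have ht0 : t ≠ 0 := by simp [ht]
  set A : Fin n → PowerSeries ℂ := fun i => ((a i).reflect (m * (i + 1)) : ℂ[X]) with hA
  set P : (PowerSeries ℂ)[X] := X ^ n + ∑ i : Fin n, C (A i) * X ^ (n - 1 - (i : ℕ)) with hP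
  have hmap : P.map (PowerSeries.constantCoeff (R := ℂ)) = ∏ i, (X - C (b i)) := by
    rw [← hbroots]
    simp [hP, hA, hα, Polynomial.map_sum, Polynomial.coeff_reflect, Polynomial.revAt_le]
  have hsep : (∏ i, (X - C (b i))).Separable := separable_prod_X_sub_C_iff.2 hbdist
  have hroot (i : Fin n) : (∏ i, (X - C (b i))).eval (b i) = 0 := by
    rw [eval_prod]
    exact Finset.prod_eq_zero (Finset.mem_univ i) (by simp)
  have hv (i : Fin n) : ∃ v : PowerSeries ℂ, P.IsRoot v ∧ PowerSeries.X ∣ v - PowerSeries.C (b i) := by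
    refine PowerSeries.exists_isRoot_of_map_constantCoeff
      (monic_X_pow_add (degree_sum_C_mul_X_pow_rev_lt A)) ?_ ?_
    · rw [hmap, hroot]
    · rw [hmap]
      exact hsep.eval₂_derivative_ne_zero (RingHom.id ℂ) (hroot i)
  choose v hvroot hvb using hv
  have hvconst (i : Fin n) : PowerSeries.constantCoeff (v i) = b i := by
    simpa [PowerSeries.X_dvd_iff, sub_eq_zero] using hvb i
  refine ⟨fun i => (t ^ m)⁻¹ * HahnSeries.ofPowerSeries ℤ ℂ (v i), ?_, fun i => ?_⟩
  · refine X_pow_add_eq_prod_of_injective_of_eval_eq_zero (degree_sum_C_mul_X_pow_rev_lt aTilde)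
      (fun i j hij => hbdist ?_) fun i => ?_
    · rw [← hvconst i, ← hvconst j, HahnSeries.ofPowerSeries_injective
        (mul_left_cancel₀ (inv_ne_zero (pow_ne_zero m ht0)) hij)]
    · have hroot := congrArg (HahnSeries.ofPowerSeries ℤ ℂ) (hvroot i).eq_zero
      set u := HahnSeries.ofPowerSeries ℤ ℂ (v i) with hu
      have hterm (j : Fin n) : (t ^ m) ^ n * (aTilde j * ((t ^ m)⁻¹ * u) ^ (n - 1 - (j : ℕ))) =
          t ^ (m * (j + 1)) * aTilde j * u ^ (n - 1 - (j : ℕ)) := by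
        have hn' : n = (j + 1) + (n - 1 - j) := by omega
        have : (t ^ m) ^ n = (t ^ m) ^ ((j : ℕ) + 1) * (t ^ m) ^ (n - 1 - (j : ℕ)) := by
          rw [← pow_add, ← hn']
        rw [this, mul_pow, inv_pow, pow_mul]
        field_simp
      refine (mul_eq_zero.1 ?_).resolve_left (pow_ne_zero n (pow_ne_zero m ht0))
      rw [map_zero] at hroot
      rw [← hroot]
      simp only [hP, eval_add, eval_pow, eval_X, eval_finsetSum, eval_mul, eval_C, map_add, map_sum,
        map_mul, map_pow, hA, hcoeff, mul_add (_ ^ n), Finset.mul_sum, hterm, ← hu]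
      rw [← mul_pow, mul_inv_cancel_left₀ (pow_ne_zero m ht0)]
  · obtain ⟨p, hp⟩ := hvb i
    refine ⟨p, ?_⟩
    rw [mul_inv_cancel_left₀ (pow_ne_zero m ht0), ht, ← HahnSeries.ofPowerSeries_X, ← map_mul, ← hp,
      map_sub, HahnSeries.ofPowerSeries_C]
    simp [HahnSeries.algebraMap_apply']
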